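/- Solomon's formula: in a finite Coxeter group W, the alternating sum over all subsets J of S of (−1)^{|J|} times the permutation character of the action of W on cosets of W_J equals the sign character: Σ_{J ⊆ S} (−1)^{|J|} π_J(w) = (−1)^{ℓ(w)} for every w ∈ W. -/

import Mathlib

namespace CoxeterSystem

open List

variable {B W : Type*} [Group W] {M : CoxeterMatrix B} (cs : CoxeterSystem M W)

open Classical in
/-- The involution `(t, e) ↦ (s t s⁻¹, e + [t = s])` of `W × ZMod 2`. -/
noncomputable def signedConj (s : W) : Function.End (W × ZMod 2) :=
  fun p ↦ (s * p.1 * s⁻¹, p.2 + if p.1 = s then 1 else 0)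

open Classical in
theorem signedConj_mul_pow_apply {s s' : W} (hs : s * s = 1) (hs' : s' * s' = 1) (n : ℕ)
    (t : W) (e : ZMod 2) :
    ((signedConj s * signedConj s') ^ n) (t, e) =
      ((s * s') ^ n * t * ((s * s') ^ n)⁻¹,
        e + ∑ j ∈ Finset.range (2 * n), if t = ((s * s') ^ j)⁻¹ * s' then 1 else 0) := by
  have hsi : s⁻¹ = s := inv_eq_of_mul_eq_one_right hs
  have hsi' : s'⁻¹ = s' := inv_eq_of_mul_eq_one_right hs'
  induction n generalizing t e with
  | zero =>
    simp only [pow_zero, mul_zero, Finset.range_zero, Finset.sum_empty, add_zero, one_mul, inv_one,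
      mul_one]
    rfl
  | succ n ih =>
    have step : (signedConj s * signedConj s') (t, e) =
        (s * s' * t * (s * s')⁻¹,
          e + ((if t = s' then 1 else 0) + if t = (s * s')⁻¹ * s' then 1 else 0)) := by
      change signedConj s (signedConj s' (t, e)) = _
      have h : s' * t * s'⁻¹ = s ↔ t = (s * s')⁻¹ * s' := by
        rw [mul_inv_rev, hsi]
        constructor
        · rintro rfl; simp [mul_assoc]
        · rintro rfl; simp [mul_assoc]
      simp only [signedConj, h, add_assoc]
      simp only [mul_inv_rev, mul_assoc]
    rw [pow_succ]
    change ((signedConj s * signedConj s') ^ n) ((signedConj s * signedConj s') (t, e)) = _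
    rw [step, ih, mul_add, mul_one, Finset.sum_range_succ', Finset.sum_range_succ']
    have h (j : ℕ) : s * s' * t * (s * s')⁻¹ = ((s * s') ^ j)⁻¹ * s' ↔
        t = ((s * s') ^ (j + 1 + 1))⁻¹ * s' := by
      have h₁ : ((s * s') ^ (j + 1 + 1))⁻¹ * s' =
          (s * s')⁻¹ * (((s * s') ^ j)⁻¹ * s') * (s * s') := by
        rw [pow_succ, pow_succ', mul_inv_rev, mul_inv_rev]
        simp only [mul_inv_rev, hsi, hsi', mul_assoc]
      rw [h₁]
      constructor
      · intro h; rw [← h]; group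
      · rintro rfl; group
    simp only [h, zero_add, pow_one, pow_zero, inv_one, one_mul]
    refine Prod.ext ?_ (by ring)
    simp only [pow_succ, mul_inv_rev, mul_assoc]

theorem isLiftable_signedConj : M.IsLiftable fun i ↦ signedConj (cs.simple i) := by
  classical
  intro i i'
  funext ⟨t, e⟩
  rw [signedConj_mul_pow_apply (by simp) (by simp), two_mul, Finset.sum_range_add]
  simp only [pow_add, cs.simple_mul_simple_pow, one_mul]
  rw [← two_mul, (by decide : (2 : ZMod 2) = 0), zero_mul]
  simp only [inv_one, mul_one, add_zero]
  rfl

/-- `cs.inversionParity w t` is the parity of the number of occurrences of `t` in the right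
inversion sequence of any word for `w`. -/
noncomputable def inversionParity (w t : W) : ZMod 2 :=
  (cs.lift ⟨_, cs.isLiftable_signedConj⟩ w (t, 0)).2

theorem lift_signedConj_apply (w t : W) (e : ZMod 2) :
    cs.lift ⟨_, cs.isLiftable_signedConj⟩ w (t, e) =
      (w * t * w⁻¹, e + cs.inversionParity w t) := by
  induction w using cs.simple_induction_left generalizing t e with
  | one =>
    simp only [inversionParity, map_one, one_mul, inv_one, mul_one]
    exact Prod.ext rfl (add_zero e).symm
  | mul_simple_left w i ih =>
    have h (e : ZMod 2) : cs.lift ⟨_, cs.isLiftable_signedConj⟩ (cs.simple i * w) (t, e) =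
        signedConj (cs.simple i) (cs.lift ⟨_, cs.isLiftable_signedConj⟩ w (t, e)) := by
      rw [map_mul, cs.lift_apply_simple]
      rfl
    rw [inversionParity, h, h, ih, ih]
    simp [signedConj, mul_assoc, add_assoc]

theorem inversionParity_mul (x y t : W) :
    cs.inversionParity (x * y) t =
      cs.inversionParity y t + cs.inversionParity x (y * t * y⁻¹) := by
  have h : cs.lift ⟨_, cs.isLiftable_signedConj⟩ (x * y) (t, 0) =
      cs.lift ⟨_, cs.isLiftable_signedConj⟩ x
        (cs.lift ⟨_, cs.isLiftable_signedConj⟩ y (t, 0)) := by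
    rw [map_mul]
    rfl
  rw [inversionParity, h, lift_signedConj_apply, lift_signedConj_apply, zero_add]

open Classical in
theorem inversionParity_simple (i : B) (t : W) :
    cs.inversionParity (cs.simple i) t = if t = cs.simple i then 1 else 0 := by
  rw [inversionParity, cs.lift_apply_simple, signedConj, zero_add]

theorem inversionParity_one (t : W) : cs.inversionParity 1 t = 0 := by
  simpa using cs.inversionParity_mul 1 1 t

open Classical in
theorem inversionParity_wordProd (ω : List B) (t : W) :
    cs.inversionParity (cs.wordProd ω) t = (cs.rightInvSeq ω).count t := by
  induction ω with
  | nil => simp [inversionParity_one]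
  | cons i ω ih =>
    rw [wordProd_cons, inversionParity_mul, ih, inversionParity_simple, rightInvSeq, count_cons]
    have : cs.wordProd ω * t * (cs.wordProd ω)⁻¹ = cs.simple i ↔
        (cs.wordProd ω)⁻¹ * cs.simple i * cs.wordProd ω = t := by
      rw [mul_inv_eq_iff_eq_mul, mul_assoc, inv_mul_eq_iff_eq_mul, eq_comm]
    simp [this]

theorem IsReflection.inversionParity_self {t : W} (ht : cs.IsReflection t) :
    cs.inversionParity t t = 1 := by
  obtain ⟨w, i, rfl⟩ := ht
  have h := cs.inversionParity_mul w w⁻¹ (w * cs.simple i * w⁻¹)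
  rw [mul_inv_cancel, inversionParity_one] at h
  have e : w⁻¹ * (w * cs.simple i * w⁻¹) * w⁻¹⁻¹ = cs.simple i := by group
  rw [e] at h
  rw [inversionParity_mul, e, inversionParity_mul, inversionParity_simple, if_pos rfl]
  simp only [inv_simple, simple_mul_simple_self, one_mul]
  linear_combination -h

theorem mem_rightInvSeq_iff_inversionParity {ω : List B} (hω : cs.IsReduced ω) (t : W) :
    t ∈ cs.rightInvSeq ω ↔ cs.inversionParity (cs.wordProd ω) t = 1 := by
  classical
  rw [inversionParity_wordProd, hω.nodup_rightInvSeq.count]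
  split_ifs with h <;> simp [h]

theorem isRightInversion_of_inversionParity {w t : W} (h : cs.inversionParity w t = 1) :
    cs.IsRightInversion w t := by
  obtain ⟨ω, hω, rfl⟩ := cs.exists_isReduced w
  exact cs.isRightInversion_of_mem_rightInvSeq hω
    ((cs.mem_rightInvSeq_iff_inversionParity hω t).2 h)

theorem isRightInversion_iff_inversionParity {w t : W} (ht : cs.IsReflection t) :
    cs.IsRightInversion w t ↔ cs.inversionParity w t = 1 := by
  refine ⟨fun h ↦ ?_, cs.isRightInversion_of_inversionParity⟩
  by_contra h₁
  have h₀ : cs.inversionParity w t = 0 := by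
    generalize cs.inversionParity w t = a at h₁
    revert a; decide
  have h₂ : cs.inversionParity (w * t) t = 1 := by
    rw [inversionParity_mul, ht.inversionParity_self, mul_inv_cancel_right, h₀, add_zero]
  exact ht.isRightInversion_mul_left_iff.1 (cs.isRightInversion_of_inversionParity h₂) h

/-- The cocycle property of left inversion sets. -/
theorem IsReflection.isLeftInversion_mul_iff {t : W} (ht : cs.IsReflection t) (x y : W) :
    cs.IsLeftInversion (x * y) t ↔
      ¬(cs.IsLeftInversion x t ↔ cs.IsLeftInversion y (x⁻¹ * t * x)) := by
  have ht' : cs.IsReflection (x⁻¹ * t * x) := by simpa using ht.conj x⁻¹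
  rw [← isRightInversion_inv_iff, ← isRightInversion_inv_iff, ← isRightInversion_inv_iff,
    isRightInversion_iff_inversionParity _ ht, isRightInversion_iff_inversionParity _ ht,
    isRightInversion_iff_inversionParity _ ht', mul_inv_rev, inversionParity_mul, inv_inv]
  generalize cs.inversionParity x⁻¹ t = a
  generalize cs.inversionParity y⁻¹ (x⁻¹ * t * x) = b
  revert a b
  decide

end CoxeterSystem

namespace CoxeterSystem

variable {B W : Type*} [Group W] {M : CoxeterMatrix B} (cs : CoxeterSystem M W)

theorem isReflection_of_mem_range_simple {s : W} (hs : s ∈ Set.range cs.simple) :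
    cs.IsReflection s := by
  obtain ⟨i, rfl⟩ := hs
  exact cs.isReflection_simple i

theorem not_isLeftInversion_one (t : W) : ¬cs.IsLeftInversion 1 t := by
  simp [IsLeftInversion]

theorem isLeftInversion_simple_iff {s : W} (hs : s ∈ Set.range cs.simple) (t : W) :
    cs.IsLeftInversion s t ↔ t = s := by
  obtain ⟨i, rfl⟩ := hs
  constructor
  · rintro ⟨-, h⟩
    rw [length_simple, Nat.lt_one_iff, length_eq_zero_iff] at h
    rw [eq_inv_of_mul_eq_one_left h, inv_simple]
  · rintro rfl
    simp [IsLeftInversion, isReflection_simple]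

theorem IsReflection.isLeftInversion_inv_iff_conj {t : W} (ht : cs.IsReflection t) (x : W) :
    cs.IsLeftInversion x⁻¹ t ↔ cs.IsLeftInversion x (x * t * x⁻¹) := by
  have h := ht.isLeftInversion_mul_iff cs x⁻¹ x
  rw [inv_mul_cancel, inv_inv] at h
  have := cs.not_isLeftInversion_one t
  tauto

/-- Left inversions of a simple reflection times an element. -/
theorem IsReflection.isLeftInversion_simple_mul_iff {t : W} (ht : cs.IsReflection t) {s : W}
    (hs : s ∈ Set.range cs.simple) (x : W) :
    cs.IsLeftInversion (s * x) t ↔ ¬(t = s ↔ cs.IsLeftInversion x (s * t * s)) := by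
  rw [ht.isLeftInversion_mul_iff, isLeftInversion_simple_iff _ hs,
    (cs.isReflection_of_mem_range_simple hs).inv]

theorem mem_closure_of_isLeftInversion {J : Set W} (hJ : J ⊆ Set.range cs.simple)
    {w t : W} (hw : w ∈ Subgroup.closure J)
    (ht : cs.IsLeftInversion w t) : t ∈ Subgroup.closure J := by
  induction hw using Subgroup.closure_induction generalizing t with
  | mem s hs =>
    rw [(cs.isLeftInversion_simple_iff (hJ hs) t).1 ht]
    exact Subgroup.subset_closure hs
  | one => exact (cs.not_isLeftInversion_one t ht).elim
  | mul x y hx hy ihx ihy =>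
    rw [ht.1.isLeftInversion_mul_iff] at ht
    by_cases h : cs.IsLeftInversion x t
    · exact ihx h
    · have := ihy (t := x⁻¹ * t * x) (by tauto)
      rwa [Subgroup.mul_mem_cancel_right _ hx, Subgroup.mul_mem_cancel_left _ (inv_mem hx)] at this
  | inv x hx ih =>
    have := ih ((ht.1.isLeftInversion_inv_iff_conj cs x).1 ht)
    rwa [Subgroup.mul_mem_cancel_right _ (inv_mem hx), Subgroup.mul_mem_cancel_left _ hx] at this

/-- The exchange property for words with letters in `J`. -/
theorem exists_shorter_of_isLeftInversion_prod {J : Set W} (hJ : J ⊆ Set.range cs.simple)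
    {t : W} {l : List W} (hl : ∀ s ∈ l, s ∈ J)
    (ht : cs.IsLeftInversion l.prod t) :
    ∃ l' : List W, (∀ s ∈ l', s ∈ J) ∧ l'.length < l.length ∧ t * l.prod = l'.prod := by
  induction l generalizing t with
  | nil => exact (cs.not_isLeftInversion_one t ht).elim
  | cons s l ih =>
    have hs : s ∈ J := hl s (by simp)
    have hss := (cs.isReflection_of_mem_range_simple (hJ hs)).mul_self
    rw [List.prod_cons, ht.1.isLeftInversion_simple_mul_iff cs (hJ hs)] at ht
    by_cases h : t = s
    · refine ⟨l, fun x hx ↦ hl x (by simp [hx]), by simp, ?_⟩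
      rw [h, List.prod_cons, ← mul_assoc, hss, one_mul]
    · obtain ⟨l', h₁, h₂, h₃⟩ := ih (fun x hx ↦ hl x (by simp [hx])) (t := s * t * s) (by tauto)
      refine ⟨s :: l', ?_, by simpa using h₂, ?_⟩
      · simpa [hs] using h₁
      · rw [List.prod_cons, List.prod_cons, ← h₃]
        simp only [← mul_assoc, hss, one_mul]

theorem exists_mem_isLeftInversion {J : Set W} (hJ : J ⊆ Set.range cs.simple)
    {w : W} (hw : w ∈ Subgroup.closure J) (hw₁ : w ≠ 1) :
    ∃ s ∈ J, cs.IsLeftInversion w s := by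
  obtain ⟨l, hl, rfl⟩ : ∃ l : List W, (∀ s ∈ l, s ∈ J) ∧ l.prod = w := by
    rw [← Subgroup.mem_toSubmonoid, Subgroup.closure_toSubmonoid] at hw
    obtain ⟨l, hl, rfl⟩ := Submonoid.exists_list_of_mem_closure hw
    refine ⟨l, fun s hs ↦ (hl s hs).elim id fun h ↦ ?_, rfl⟩
    rwa [Set.mem_inv, ← (cs.isReflection_of_mem_range_simple (hJ h)).inv, inv_inv] at h
  induction hn : l.length using Nat.strong_induction_on generalizing l with
  | _ n ih =>
    cases l with
    | nil => exact (hw₁ rfl).elim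
    | cons s l =>
      have hs : s ∈ J := hl s (by simp)
      have hl' : ∀ x ∈ l, x ∈ J := fun x hx ↦ hl x (by simp [hx])
      by_cases h : cs.IsLeftInversion (s :: l).prod s
      · exact ⟨s, hs, h⟩
      · have hr := cs.isReflection_of_mem_range_simple (hJ hs)
        rw [List.prod_cons, hr.isLeftInversion_simple_mul_iff cs (hJ hs), hr.mul_self,
          one_mul] at h
        obtain ⟨l', h₁, h₂, h₃⟩ := cs.exists_shorter_of_isLeftInversion_prod hJ hl'
          (t := s) (by tauto)
        rw [← List.prod_cons] at h₃
        rw [h₃] at hw hw₁ ⊢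
        exact ih l'.length (by simp only [List.length_cons] at hn; lia) l' h₁ hw hw₁ rfl

theorem mem_of_mem_closure {J : Set W} (hJ : J ⊆ Set.range cs.simple)
    {s : W} (hs : s ∈ Set.range cs.simple)
    (hsJ : s ∈ Subgroup.closure J) : s ∈ J := by
  have hs₁ : s ≠ 1 := by
    obtain ⟨i, rfl⟩ := hs
    rw [Ne, ← cs.length_eq_zero_iff, length_simple]
    exact one_ne_zero
  obtain ⟨s', hs', h⟩ := cs.exists_mem_isLeftInversion hJ hsJ hs₁
  rwa [(cs.isLeftInversion_simple_iff hs s').1 h] at hs'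

theorem mem_closure_inter {J : Set W} (hJ : J ⊆ Set.range cs.simple)
    {K : Set W} (hK : K ⊆ Set.range cs.simple) {w : W}
    (hwJ : w ∈ Subgroup.closure J) (hwK : w ∈ Subgroup.closure K) :
    w ∈ Subgroup.closure (J ∩ K) := by
  induction hn : cs.length w using Nat.strong_induction_on generalizing w with
  | _ n ih =>
    by_cases hw : w = 1
    · exact hw ▸ one_mem _
    obtain ⟨s, hs, h⟩ := cs.exists_mem_isLeftInversion hJ hwJ hw
    have hs' := cs.mem_closure_of_isLeftInversion hK hwK h
    have hsK := cs.mem_of_mem_closure hK (hJ hs) hs'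
    have := ih _ (hn ▸ h.2) (mul_mem (Subgroup.subset_closure hs) hwJ) (mul_mem hs' hwK) rfl
    rwa [Subgroup.mul_mem_cancel_left _ (Subgroup.subset_closure (Set.mem_inter hs hsK))] at this

/-- `x` has no left inversion in the parabolic subgroup generated by `J`. -/
def IsCosetMin (J : Set W) (x : W) : Prop :=
  ∀ t ∈ Subgroup.closure J, ¬cs.IsLeftInversion x t

/-- Every reflection in the parabolic subgroup generated by `J` is a left inversion of `x`. -/
def IsCosetMax (J : Set W) (x : W) : Prop :=
  ∀ t ∈ Subgroup.closure J, cs.IsReflection t → cs.IsLeftInversion x t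

theorem exists_isCosetMin (J : Set W) (x : W) :
    ∃ a ∈ Subgroup.closure J, cs.IsCosetMin J (a * x) := by
  let f (a : Subgroup.closure J) : ℕ := cs.length (a * x)
  obtain ⟨⟨a, ha⟩, h⟩ : ∃ a, ∀ b, f a ≤ f b := ⟨_, fun b ↦ Function.argmin_le f b⟩
  refine ⟨a, ha, fun t ht h' ↦ ?_⟩
  have : cs.length (a * x) ≤ cs.length (t * a * x) := h ⟨t * a, mul_mem ht ha⟩
  rw [mul_assoc] at this
  exact this.not_gt h'.2

theorem exists_isCosetMax [Finite W] (J : Set W) (x : W) :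
    ∃ a ∈ Subgroup.closure J, cs.IsCosetMax J (a * x) := by
  obtain ⟨⟨a, ha⟩, h⟩ := Finite.exists_max fun a : Subgroup.closure J ↦ cs.length (a * x)
  refine ⟨a, ha, fun t ht h' ↦ ⟨h', ?_⟩⟩
  have := h ⟨t * a, mul_mem ht ha⟩
  rw [Subtype.coe_mk, mul_assoc] at this
  exact lt_of_le_of_ne this (h'.length_mul_right_ne _)

theorem IsCosetMin.eq_one {J : Set W} (hJ : J ⊆ Set.range cs.simple)
    {x : W} (hx : cs.IsCosetMin J x) {a : W} (ha : a ∈ Subgroup.closure J)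
    (h : ∀ s ∈ J, ¬cs.IsLeftInversion (a * x) s) : a = 1 := by
  by_contra ha₁
  obtain ⟨s, hs, hsa⟩ := cs.exists_mem_isLeftInversion hJ ha ha₁
  have h' := h s hs
  rw [hsa.1.isLeftInversion_mul_iff] at h'
  exact hx (a⁻¹ * s * a) (mul_mem (mul_mem (inv_mem ha) (Subgroup.subset_closure hs)) ha)
    (by tauto)

theorem IsCosetMax.eq_one {J : Set W} (hJ : J ⊆ Set.range cs.simple)
    {x : W} (hx : cs.IsCosetMax J x) {a : W} (ha : a ∈ Subgroup.closure J)
    (h : ∀ s ∈ J, cs.IsLeftInversion (a * x) s) : a = 1 := by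
  by_contra ha₁
  obtain ⟨s, hs, hsa⟩ := cs.exists_mem_isLeftInversion hJ ha ha₁
  have h' := h s hs
  rw [hsa.1.isLeftInversion_mul_iff] at h'
  have := hx (a⁻¹ * s * a) (mul_mem (mul_mem (inv_mem ha) (Subgroup.subset_closure hs)) ha)
    (by simpa using hsa.1.conj a⁻¹)
  tauto

theorem existsUnique_isCosetMin {J : Set W} (hJ : J ⊆ Set.range cs.simple)
    (x : W) :
    ∃! a : W, a ∈ Subgroup.closure J ∧ ∀ s ∈ J, ¬cs.IsLeftInversion (a * x) s := by
  obtain ⟨a, ha, h⟩ := cs.exists_isCosetMin J x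
  refine ⟨a, ⟨ha, fun s hs ↦ h s (Subgroup.subset_closure hs)⟩, fun b ⟨hb, hb'⟩ ↦ ?_⟩
  rw [← mul_inv_eq_one]
  exact h.eq_one cs hJ (mul_mem hb (inv_mem ha)) (by simpa [mul_assoc] using hb')

theorem existsUnique_isCosetMax {J : Set W} (hJ : J ⊆ Set.range cs.simple)
    [Finite W] (x : W) :
    ∃! a : W, a ∈ Subgroup.closure J ∧ ∀ s ∈ J, cs.IsLeftInversion (a * x) s := by
  obtain ⟨a, ha, h⟩ := cs.exists_isCosetMax J x
  refine ⟨a, ⟨ha, fun s hs ↦ h s (Subgroup.subset_closure hs)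
    (cs.isReflection_of_mem_range_simple (hJ hs))⟩, fun b ⟨hb, hb'⟩ ↦ ?_⟩
  rw [← mul_inv_eq_one]
  exact h.eq_one cs hJ (mul_mem hb (inv_mem ha)) (by simpa [mul_assoc] using hb')

theorem isCosetMax_of_forall {J : Set W} (hJ : J ⊆ Set.range cs.simple)
    [Finite W] {x : W} (h : ∀ s ∈ J, cs.IsLeftInversion x s) :
    cs.IsCosetMax J x := by
  obtain ⟨a, ha, h'⟩ := cs.exists_isCosetMax J x
  have : a⁻¹ = 1 := h'.eq_one cs hJ (inv_mem ha) (by simpa using h)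
  rwa [inv_eq_one.1 this, one_mul] at h'

theorem conj_mem_of_isCosetMax {D : Set W} (hD : D ⊆ Set.range cs.simple) {a : W}
    (ha : a ∈ Subgroup.closure D) (hmax : cs.IsCosetMax D a) {s : W} (hs : s ∈ D) :
    a⁻¹ * s * a ∈ D := by
  have hsP : s ∈ Subgroup.closure D := Subgroup.subset_closure hs
  have hsr := cs.isReflection_of_mem_range_simple (hD hs)
  have hr : cs.IsReflection (a⁻¹ * s * a) := by simpa using hsr.conj a⁻¹
  have hr₁ : a⁻¹ * s * a ≠ 1 := by
    intro h
    have := hr.odd_length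
    rw [h, length_one] at this
    exact absurd this (by decide)
  obtain ⟨s', hs', h⟩ := cs.exists_mem_isLeftInversion hD
    (mul_mem (mul_mem (inv_mem ha) hsP) ha) hr₁
  have hs'P : a * s' * a⁻¹ ∈ Subgroup.closure D :=
    mul_mem (mul_mem ha (Subgroup.subset_closure hs')) (inv_mem ha)
  have hc : cs.IsReflection (a * s' * a⁻¹) := h.1.conj a
  have h₁ := (h.1.isLeftInversion_inv_iff_conj cs a).2 (hmax _ hs'P hc)
  have h₂ := hmax (s * (a * s' * a⁻¹) * s) (mul_mem (mul_mem hsP hs'P) hsP)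
    (by simpa [hsr.inv] using hc.conj s)
  rw [mul_assoc, h.1.isLeftInversion_mul_iff, inv_inv,
    hc.isLeftInversion_simple_mul_iff cs (hD hs)] at h
  have h₃ : a * s' * a⁻¹ = s := by tauto
  rw [← h₃]
  simpa [mul_assoc] using hs'

theorem IsCosetMax.inv {D : Set W} {a : W} (ha : a ∈ Subgroup.closure D)
    (hmax : cs.IsCosetMax D a) : cs.IsCosetMax D a⁻¹ := fun _ ht h ↦
  (h.isLeftInversion_inv_iff_conj cs a).2
    (hmax _ (mul_mem (mul_mem ha ht) (inv_mem ha)) (h.conj a))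

/-- If `y` is minimal in its double coset of `⟨D⟩` and `⟨L⟩`, then the intersection of `⟨D⟩` with
the conjugate of `⟨L⟩` by `y` is generated by simple reflections. -/
theorem mem_closure_of_isCosetMin {D L : Set W} (hD : D ⊆ Set.range cs.simple)
    (hL : L ⊆ Set.range cs.simple) {y : W} (hyD : cs.IsCosetMin D y)
    (hyL : cs.IsCosetMin L y⁻¹) {v w : W} (hv : v ∈ Subgroup.closure D)
    (hw : w ∈ Subgroup.closure L) (h : v * y = y * w) :
    v ∈ Subgroup.closure {s ∈ D | y⁻¹ * s * y ∈ L} := by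
  induction hn : cs.length v using Nat.strong_induction_on generalizing v w with
  | _ n ih =>
    by_cases hv₁ : v = 1
    · exact hv₁ ▸ one_mem _
    obtain ⟨s, hs, hsv⟩ := cs.exists_mem_isLeftInversion hD hv hv₁
    have hsP : s ∈ Subgroup.closure D := Subgroup.subset_closure hs
    have hsr := hsv.1
    have h₁ : cs.IsLeftInversion (y * w) s := by
      have := hyD (v⁻¹ * s * v) (mul_mem (mul_mem (inv_mem hv) hsP) hv)
      rw [← h, hsr.isLeftInversion_mul_iff]
      tauto
    have h₂ : cs.IsLeftInversion w (y⁻¹ * s * y) := by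
      rw [hsr.isLeftInversion_mul_iff] at h₁
      have := hyD s hsP
      tauto
    have hrP := cs.mem_closure_of_isLeftInversion hL hw h₂
    have hr := h₂.1
    have hr₁ : y⁻¹ * s * y ≠ 1 := by
      intro h
      have := hr.odd_length
      rw [h, length_one] at this
      exact absurd this (by decide)
    have hrL : y⁻¹ * s * y ∈ L := by
      obtain ⟨s', hs', h₃⟩ := cs.exists_mem_isLeftInversion hL hrP hr₁
      have hs'P : s' ∈ Subgroup.closure L := Subgroup.subset_closure hs'
      have hc : cs.IsReflection (y * s' * y⁻¹) := h₃.1.conj y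
      have h₄ := hyL s' hs'P
      have h₅ : ¬cs.IsLeftInversion y (s * (y * s' * y⁻¹) * s) := by
        have hc' : cs.IsReflection (y⁻¹ * (s * (y * s' * y⁻¹) * s) * y) := by
          have := (hc.conj s).conj y⁻¹
          rwa [hsr.inv, inv_inv] at this
        have := hc'.isLeftInversion_inv_iff_conj cs y
        have e : y * (y⁻¹ * (s * (y * s' * y⁻¹) * s) * y) * y⁻¹ = s * (y * s' * y⁻¹) * s := by
          group
        rw [e] at this
        rw [← this]
        refine hyL _ ?_
        have e : y⁻¹ * (s * (y * s' * y⁻¹) * s) * y =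
          (y⁻¹ * s * y) * s' * (y⁻¹ * s * y) := by group
        rw [e]
        exact mul_mem (mul_mem hrP hs'P) hrP
      rw [mul_assoc, h₃.1.isLeftInversion_mul_iff, inv_inv,
        hc.isLeftInversion_simple_mul_iff cs (hD hs)] at h₃
      have h₆ : y * s' * y⁻¹ = s := by tauto
      rw [← h₆]
      simpa [mul_assoc] using hs'
    have := ih _ (hn ▸ hsv.2) (mul_mem hsP hv) (mul_mem hrP hw)
      (by rw [mul_assoc, h]; group) rfl
    rwa [Subgroup.mul_mem_cancel_left] at this
    exact Subgroup.subset_closure ⟨hs, hrL⟩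

/-- If the support of `z w z⁻¹` is the left descent set of `z`, and `w` lies in a standard
parabolic subgroup, then so does `z`. -/
theorem mem_closure_of_forall_descent [Finite W] {D L : Set W} (hL : L ⊆ Set.range cs.simple)
    {w z : W} (hw : w ∈ Subgroup.closure L)
    (hD : ∀ s, s ∈ D ↔ s ∈ Set.range cs.simple ∧ cs.IsLeftInversion z s)
    (hz : z * w * z⁻¹ ∈ Subgroup.closure D)
    (hfull : ∀ J ⊆ D, z * w * z⁻¹ ∈ Subgroup.closure J → J = D) :
    z ∈ Subgroup.closure L := by
  have hDr : D ⊆ Set.range cs.simple := fun s hs ↦ ((hD s).1 hs).1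
  have hzmax := cs.isCosetMax_of_forall hDr fun s hs ↦ ((hD s).1 hs).2
  obtain ⟨b, hb, hdmin⟩ := cs.exists_isCosetMin D z
  obtain ⟨a, rfl⟩ : ∃ a, a⁻¹ = b := ⟨b⁻¹, inv_inv b⟩
  have ha : a ∈ Subgroup.closure D := (inv_mem_iff).1 hb
  obtain ⟨d, rfl⟩ : ∃ d, a * d = z := ⟨a⁻¹ * z, by group⟩
  rw [inv_mul_cancel_left] at hdmin
  have hamax : cs.IsCosetMax D a := by
    intro t ht hr
    have h₁ := hzmax t ht hr
    rw [hr.isLeftInversion_mul_iff] at h₁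
    have h₂ := hdmin (a⁻¹ * t * a) (mul_mem (mul_mem hb ht) ha)
    tauto
  obtain ⟨u, hu, hymin⟩ := cs.exists_isCosetMin L d⁻¹
  obtain ⟨y, rfl⟩ : ∃ y, y * u = d := ⟨d * u⁻¹, by group⟩
  have e : u * (y * u)⁻¹ = y⁻¹ := by group
  rw [e] at hymin
  have hydmin : cs.IsCosetMin D y := by
    intro t ht hty
    have h₁ := hdmin t ht
    rw [hty.1.isLeftInversion_mul_iff] at h₁
    have h₂ : cs.IsLeftInversion u (y⁻¹ * t * y) := by tauto
    refine hymin _ (cs.mem_closure_of_isLeftInversion hL hu h₂)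
      ((h₂.1.isLeftInversion_inv_iff_conj cs y).2 ?_)
    simpa [mul_assoc] using hty
  have hv : a⁻¹ * (a * (y * u) * w * (a * (y * u))⁻¹) * a ∈ Subgroup.closure D :=
    mul_mem (mul_mem hb hz) ha
  have hv' := cs.mem_closure_of_isCosetMin hDr hL hydmin hymin hv
    (mul_mem (mul_mem hu hw) (inv_mem hu)) (by group)
  have hDL : ∀ s ∈ D, y⁻¹ * s * y ∈ L := by
    have h := hfull {s ∈ D | a⁻¹ * s * a ∈ {s ∈ D | y⁻¹ * s * y ∈ L}} (fun s hs ↦ hs.1) ?_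
    · intro s hs
      have h₁ : a * s * a⁻¹ ∈ D := by
        simpa using cs.conj_mem_of_isCosetMax hDr hb (hamax.inv cs ha) hs
      rw [← h] at h₁
      simpa [mul_assoc] using h₁.2.2
    · have h : Subgroup.closure {s ∈ D | y⁻¹ * s * y ∈ L} ≤ (Subgroup.closure
          {s ∈ D | a⁻¹ * s * a ∈ {s ∈ D | y⁻¹ * s * y ∈ L}}).comap
            (MulAut.conj a).toMonoidHom := by
        rw [Subgroup.closure_le]
        intro s hs
        refine Subgroup.subset_closure ⟨?_, ?_⟩
        · simpa using cs.conj_mem_of_isCosetMax hDr hb (hamax.inv cs ha) hs.1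
        · simpa [mul_assoc] using hs
      have := h hv'
      simpa [mul_assoc] using this
  have haL : y⁻¹ * a * y ∈ Subgroup.closure L := by
    have h : Subgroup.closure D ≤ (Subgroup.closure L).comap (MulAut.conj y⁻¹).toMonoidHom := by
      rw [Subgroup.closure_le]
      intro s hs
      refine Subgroup.subset_closure ?_
      simpa using hDL s hs
    simpa using h ha
  have hz' : a * (y * u) = y * (y⁻¹ * a * y * u) := by group
  have hu' := mul_mem haL hu
  suffices y = 1 by rwa [hz', this, one_mul, ← this]
  by_contra hy₁
  obtain ⟨i, hi⟩ := cs.exists_leftDescent_of_ne_one hy₁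
  have hi' : cs.IsLeftInversion y (cs.simple i) :=
    (cs.isLeftInversion_simple_iff_isLeftDescent y i).2 hi
  refine hydmin _ (Subgroup.subset_closure ((hD _).2 ⟨⟨i, rfl⟩, ?_⟩)) hi'
  rw [hz', hi'.1.isLeftInversion_mul_iff]
  suffices ¬cs.IsLeftInversion (y⁻¹ * a * y * u) (y⁻¹ * cs.simple i * y) by tauto
  intro h
  refine hymin _ (cs.mem_closure_of_isLeftInversion hL hu' h)
    ((h.1.isLeftInversion_inv_iff_conj cs y).2 ?_)
  simpa [mul_assoc] using hi'

end CoxeterSystem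

section FiniteGroup

open Finset
open scoped Classical

variable {G : Type*} [Group G] [Fintype G]

theorem Subgroup.card_filter_mul_card_of_existsUnique {P Q : Subgroup G} (hPQ : P ≤ Q)
    {R : G → Prop} (hR : ∀ x, ∃! a, a ∈ P ∧ R (a * x)) (w : G) :
    #{x : G | x ∈ Q ∧ R x ∧ x * w * x⁻¹ ∈ P} * #{x | x ∈ P} =
      #{x : G | x ∈ Q ∧ x * w * x⁻¹ ∈ P} := by
  rw [← card_product]
  refine card_bij (fun p _ ↦ p.2 * p.1) ?_ ?_ ?_
  · rintro ⟨x, a⟩ h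
    simp only [mem_product, mem_filter, mem_univ, true_and] at h ⊢
    refine ⟨mul_mem (hPQ h.2) h.1.1, ?_⟩
    have := mul_mem (mul_mem h.2 h.1.2.2) (inv_mem h.2)
    simpa [mul_assoc] using this
  · rintro ⟨x, a⟩ h ⟨y, b⟩ h' e
    simp only [mem_product, mem_filter, mem_univ, true_and] at h h' e
    have hx : x = a⁻¹ * b * y := by rw [mul_assoc, ← e, inv_mul_cancel_left]
    have h₁ := (hR y).unique (y₁ := a⁻¹ * b) (y₂ := 1)
      ⟨mul_mem (inv_mem h.2) h'.2, hx ▸ h.1.2.1⟩ ⟨one_mem _, by simpa using h'.1.2.1⟩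
    rw [h₁, one_mul] at hx
    rw [hx, inv_mul_eq_one.1 h₁]
  · intro y h
    simp only [mem_filter, mem_univ, true_and] at h
    obtain ⟨a, ⟨ha, hay⟩, -⟩ := hR y
    refine ⟨(a * y, a⁻¹), ?_, by simp⟩
    simp only [mem_product, mem_filter, mem_univ, true_and]
    refine ⟨⟨mul_mem (hPQ ha) h.1, hay, ?_⟩, inv_mem ha⟩
    have := mul_mem (mul_mem ha h.2) (inv_mem ha)
    simpa [mul_assoc] using this

theorem Subgroup.card_filter_conj_mem_conj (P : Subgroup G) {Q : Subgroup G} {g : G}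
    (hg : g ∈ Q) (w : G) :
    #{x : G | x ∈ Q ∧ x * (g * w * g⁻¹) * x⁻¹ ∈ P} = #{x : G | x ∈ Q ∧ x * w * x⁻¹ ∈ P} := by
  refine card_bij' (fun x _ ↦ x * g) (fun x _ ↦ x * g⁻¹) ?_ ?_ (by simp) (by simp)
  · intro x h
    simp only [mem_filter, mem_univ, true_and] at h ⊢
    exact ⟨mul_mem h.1 hg, by simpa [mul_assoc] using h.2⟩
  · intro x h
    simp only [mem_filter, mem_univ, true_and] at h ⊢
    exact ⟨mul_mem h.1 (inv_mem hg), by simpa [mul_assoc] using h.2⟩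

theorem Subgroup.sum_card_filter_conj_mem {P Q : Subgroup G} (hPQ : P ≤ Q) :
    ∑ w with w ∈ Q, #{x : G | x ∈ Q ∧ x * w * x⁻¹ ∈ P} =
      #{x | x ∈ Q} * #{x | x ∈ P} := by
  have h (w : G) : #{x : G | x ∈ Q ∧ x * w * x⁻¹ ∈ P} =
      ∑ x with x ∈ Q, if x * w * x⁻¹ ∈ P then 1 else 0 := by
    rw [← filter_filter, card_filter]
  simp only [h]
  rw [sum_comm, card_eq_sum_ones, sum_mul]
  refine sum_congr rfl fun x hx ↦ ?_
  simp only [mem_filter, mem_univ, true_and] at hx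
  rw [← card_filter, one_mul]
  refine card_bij' (fun w _ ↦ x * w * x⁻¹) (fun w _ ↦ x⁻¹ * w * x) ?_ ?_ ?_ ?_
  · intro w hw
    simp only [mem_filter, mem_univ, true_and] at hw ⊢
    exact hw.2
  · intro w hw
    simp only [mem_filter, mem_univ, true_and] at hw ⊢
    exact ⟨mul_mem (mul_mem (inv_mem hx) (hPQ hw)) hx, by simpa [mul_assoc] using hw⟩
  · intros; group
  · intros; group

theorem Finset.sum_powerset_neg_one_pow_card_mul_image {α β : Type*} (f : α → β) (s : Finset α)
    (g : Finset β → ℤ) :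
    ∑ J ∈ s.powerset, (-1 : ℤ) ^ #J * g (J.image f) =
      ∑ I ∈ (s.image f).powerset, (-1 : ℤ) ^ #I * g I := by
  induction s using Finset.induction_on generalizing g with
  | empty => simp
  | insert a s ha ih =>
    have h₁ : ∑ J ∈ s.powerset, (-1 : ℤ) ^ #(insert a J) * g ((insert a J).image f) =
        -∑ I ∈ (s.image f).powerset, (-1 : ℤ) ^ #I * g (insert (f a) I) := by
      rw [← ih fun I ↦ g (insert (f a) I), ← sum_neg_distrib]
      refine sum_congr rfl fun J hJ ↦ ?_
      rw [card_insert_of_notMem fun h ↦ ha (mem_powerset.1 hJ h), image_insert, pow_succ]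
      ring
    rw [sum_powerset_insert ha, h₁, ih, image_insert]
    by_cases hf : f a ∈ s.image f
    · rw [insert_eq_of_mem hf, ← insert_erase hf, sum_powerset_insert (notMem_erase _ _),
        sum_powerset_insert (notMem_erase _ _)]
      simp only [insert_idem]
      have : ∑ I ∈ ((s.image f).erase (f a)).powerset,
          (-1 : ℤ) ^ #(insert (f a) I) * g (insert (f a) I) =
          -∑ I ∈ ((s.image f).erase (f a)).powerset, (-1 : ℤ) ^ #I * g (insert (f a) I) := by
        rw [← sum_neg_distrib]
        refine sum_congr rfl fun J hJ ↦ ?_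
        rw [card_insert_of_notMem fun h ↦ notMem_erase (f a) _ (mem_powerset.1 hJ h), pow_succ]
        ring
      rw [this]
      ring
    · rw [sum_powerset_insert hf, ← sum_neg_distrib]
      congr 1
      refine sum_congr rfl fun J hJ ↦ ?_
      rw [card_insert_of_notMem fun h ↦ hf (mem_powerset.1 hJ h), pow_succ]
      ring

end FiniteGroup

namespace CoxeterSystem

open Finset
open scoped Classical

variable {B W : Type*} [Group W] {M : CoxeterMatrix B} (cs : CoxeterSystem M W)

theorem neg_one_pow_length_mul (x y : W) :
    (-1 : ℤ) ^ cs.length (x * y) = (-1) ^ cs.length x * (-1) ^ cs.length y := by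
  rw [← pow_add, neg_one_pow_eq_pow_mod_two, length_mul_mod_two, ← neg_one_pow_eq_pow_mod_two]

theorem neg_one_pow_length_conj (g w : W) :
    (-1 : ℤ) ^ cs.length (g * w * g⁻¹) = (-1) ^ cs.length w := by
  rw [neg_one_pow_length_mul, neg_one_pow_length_mul, length_inv, mul_right_comm, ← pow_add,
    Even.neg_one_pow ⟨_, rfl⟩, one_mul]

variable [Fintype W]

/-- The set of left descents of `x`, as elements of `W`. -/
noncomputable def leftDescentFinset (x : W) : Finset W :=
  {s | s ∈ Set.range cs.simple ∧ cs.IsLeftInversion x s}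

theorem mem_leftDescentFinset {x s : W} :
    s ∈ cs.leftDescentFinset x ↔ s ∈ Set.range cs.simple ∧ cs.IsLeftInversion x s := by
  simp [leftDescentFinset]

/-- The contribution of the group element `x` to Solomon's alternating sum at `w`. -/
noncomputable def solomonTerm (w x : W) : ℤ :=
  ∑ J ∈ (cs.leftDescentFinset x).powerset,
    if x * w * x⁻¹ ∈ Subgroup.closure (J : Set W) then (-1) ^ #J else 0

/-- The number of cosets `⟨J⟩ x` in `⟨K⟩` fixed by `w`, counted by maximal representatives. -/
noncomputable def cardFixedMax (K J : Finset W) (w : W) : ℕ :=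
  #{x : W | x ∈ Subgroup.closure (K : Set W) ∧ (∀ s ∈ (J : Set W), cs.IsLeftInversion x s) ∧
    x * w * x⁻¹ ∈ Subgroup.closure (J : Set W)}

/-- Solomon's alternating sum for the parabolic subgroup generated by `K`. -/
noncomputable def solomonSum (K : Finset W) (w : W) : ℤ :=
  ∑ J ∈ K.powerset, (-1) ^ #J * (cs.cardFixedMax K J w : ℤ)

theorem solomonTerm_eq_zero {L : Set W} (hL : L ⊆ Set.range cs.simple) {w x : W}
    (hw : w ∈ Subgroup.closure L) (hx : x ∉ Subgroup.closure L) : cs.solomonTerm w x = 0 := by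
  have hD : ((cs.leftDescentFinset x : Finset W) : Set W) ⊆ Set.range cs.simple :=
    fun s hs ↦ (cs.mem_leftDescentFinset.1 hs).1
  have mono {I J : Finset W} (h : I ⊆ J) :
      Subgroup.closure (I : Set W) ≤ Subgroup.closure (J : Set W) :=
    Subgroup.closure_mono (coe_subset.2 h)
  by_cases hz : x * w * x⁻¹ ∈ Subgroup.closure ((cs.leftDescentFinset x : Finset W) : Set W)
  · obtain ⟨J₀, h₁, h₂, h₃⟩ : ∃ J₀ ⊆ cs.leftDescentFinset x,
        x * w * x⁻¹ ∈ Subgroup.closure (J₀ : Set W) ∧ J₀ ≠ cs.leftDescentFinset x := by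
      by_contra! h
      refine hx (cs.mem_closure_of_forall_descent hL hw (fun s ↦ cs.mem_leftDescentFinset) hz ?_)
      intro J hJ hJz
      have hJ' : J.toFinset ⊆ cs.leftDescentFinset x := by
        rwa [← coe_subset, Set.coe_toFinset]
      rw [← h J.toFinset hJ' (by rwa [Set.coe_toFinset]), Set.coe_toFinset]
    obtain ⟨b, hb, hb₀⟩ := exists_of_ssubset (h₁.ssubset_of_ne h₃)
    rw [solomonTerm, ← insert_erase hb, sum_powerset_insert (notMem_erase _ _),
      ← sum_add_distrib]
    refine sum_eq_zero fun J hJ ↦ ?_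
    rw [mem_powerset] at hJ
    have hbJ : b ∉ J := fun h ↦ notMem_erase _ _ (hJ h)
    have hiff : x * w * x⁻¹ ∈ Subgroup.closure ((insert b J : Finset W) : Set W) ↔
        x * w * x⁻¹ ∈ Subgroup.closure (J : Set W) := by
      refine ⟨fun h ↦ ?_, fun h ↦ mono (subset_insert _ _) h⟩
      have hi := cs.mem_closure_inter (J := ((insert b J : Finset W) : Set W)) (K := J₀)
        ((coe_subset.2 (insert_subset hb (hJ.trans (erase_subset _ _)))).trans hD)
        ((coe_subset.2 h₁).trans hD) h h₂
      refine Subgroup.closure_mono ?_ hi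
      rintro s ⟨hs, hs₀⟩
      rw [mem_coe, mem_insert] at hs
      exact hs.resolve_left fun h ↦ hb₀ (h ▸ hs₀)
    simp only [hiff, card_insert_of_notMem hbJ, pow_succ]
    split_ifs <;> ring
  · refine sum_eq_zero fun J hJ ↦ if_neg fun h ↦ hz (mono (mem_powerset.1 hJ) h)

theorem solomonSum_eq_sum_solomonTerm {K : Finset W} (hK : (K : Set W) ⊆ Set.range cs.simple)
    (w : W) : cs.solomonSum K w =
      ∑ x with x ∈ Subgroup.closure (K : Set W), cs.solomonTerm w x := by
  have h (J : Finset W) : (cs.cardFixedMax K J w : ℤ) =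
      ∑ x with x ∈ Subgroup.closure (K : Set W), if (∀ s ∈ J, cs.IsLeftInversion x s) ∧
        x * w * x⁻¹ ∈ Subgroup.closure (J : Set W) then 1 else 0 := by
    rw [cardFixedMax, ← filter_filter, card_filter]
    push_cast
    simp only [mem_coe]
  simp only [solomonSum, h, mul_sum]
  rw [sum_comm]
  refine sum_congr rfl fun x hx ↦ ?_
  rw [mem_filter] at hx
  have hDK : cs.leftDescentFinset x ⊆ K := fun s hs ↦ by
    rw [mem_leftDescentFinset] at hs
    exact cs.mem_of_mem_closure hK hs.1 (cs.mem_closure_of_isLeftInversion hK hx.2 hs.2)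
  rw [solomonTerm, ← sum_subset (powerset_mono.2 hDK)]
  · refine sum_congr rfl fun J hJ ↦ ?_
    have : ∀ s ∈ J, cs.IsLeftInversion x s := fun s hs ↦
      (cs.mem_leftDescentFinset.1 (mem_powerset.1 hJ hs)).2
    simp only [and_iff_right this, mul_ite, mul_one, mul_zero]
  · intro J hJ hJ'
    rw [if_neg, mul_zero]
    rintro ⟨h, -⟩
    exact hJ' (mem_powerset.2 fun s hs ↦
      cs.mem_leftDescentFinset.2 ⟨hK (mem_powerset.1 hJ hs), h s hs⟩)

theorem solomonSum_eq_of_subset {K L : Finset W} (hK : (K : Set W) ⊆ Set.range cs.simple)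
    (hLK : L ⊆ K) {w : W} (hw : w ∈ Subgroup.closure (L : Set W)) :
    cs.solomonSum K w = cs.solomonSum L w := by
  have hL : (L : Set W) ⊆ Set.range cs.simple := (coe_subset.2 hLK).trans hK
  rw [solomonSum_eq_sum_solomonTerm _ hK, solomonSum_eq_sum_solomonTerm _ hL]
  symm
  refine sum_subset (fun x hx ↦ ?_) fun x _ hx ↦ cs.solomonTerm_eq_zero hL hw ?_
  · simp only [mem_filter, mem_univ, true_and] at hx ⊢
    exact Subgroup.closure_mono (coe_subset.2 hLK) hx
  · simpa using hx

theorem cardFixedMax_mul_card {K J : Finset W} (hK : (K : Set W) ⊆ Set.range cs.simple)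
    (hJK : J ⊆ K) (w : W) :
    cs.cardFixedMax K J w * #{x | x ∈ Subgroup.closure (J : Set W)} =
      #{x : W | x ∈ Subgroup.closure (K : Set W) ∧
        x * w * x⁻¹ ∈ Subgroup.closure (J : Set W)} := by
  rw [cardFixedMax]
  convert Subgroup.card_filter_mul_card_of_existsUnique
    (R := fun x ↦ ∀ s ∈ (J : Set W), cs.IsLeftInversion x s)
    (Subgroup.closure_mono (coe_subset.2 hJK))
    (cs.existsUnique_isCosetMax ((coe_subset.2 hJK).trans hK)) w

theorem _root_.Subgroup.card_filter_mem_pos (P : Subgroup W) : 0 < #{x | x ∈ P} :=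
  card_pos.2 ⟨1, by simp [one_mem]⟩

theorem solomonSum_conj {K : Finset W} (hK : (K : Set W) ⊆ Set.range cs.simple) {g : W}
    (hg : g ∈ Subgroup.closure (K : Set W)) (w : W) :
    cs.solomonSum K (g * w * g⁻¹) = cs.solomonSum K w := by
  refine sum_congr rfl fun J hJ ↦ ?_
  rw [mem_powerset] at hJ
  congr 2
  refine Nat.eq_of_mul_eq_mul_right (Subgroup.card_filter_mem_pos (Subgroup.closure (J : Set W)))
    ?_
  rw [cardFixedMax_mul_card _ hK hJ, cardFixedMax_mul_card _ hK hJ,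
    Subgroup.card_filter_conj_mem_conj _ hg]

theorem sum_solomonSum_eq_zero {K : Finset W} (hK : (K : Set W) ⊆ Set.range cs.simple)
    (hne : K.Nonempty) :
    ∑ w with w ∈ Subgroup.closure (K : Set W), cs.solomonSum K w = 0 := by
  have h (J : Finset W) (hJ : J ∈ K.powerset) :
      ∑ w with w ∈ Subgroup.closure (K : Set W), cs.cardFixedMax K J w =
        #{x | x ∈ Subgroup.closure (K : Set W)} := by
    rw [mem_powerset] at hJ
    refine Nat.eq_of_mul_eq_mul_right
      (Subgroup.card_filter_mem_pos (Subgroup.closure (J : Set W))) ?_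
    rw [sum_mul]
    simp only [cs.cardFixedMax_mul_card hK hJ]
    exact Subgroup.sum_card_filter_conj_mem (Subgroup.closure_mono (coe_subset.2 hJ))
  simp only [solomonSum]
  rw [sum_comm]
  have h' (J : Finset W) (hJ : J ∈ K.powerset) :
      ∑ w with w ∈ Subgroup.closure (K : Set W), (-1 : ℤ) ^ #J * (cs.cardFixedMax K J w : ℤ) =
        (-1) ^ #J * (#{x | x ∈ Subgroup.closure (K : Set W)} : ℤ) := by
    rw [← mul_sum, ← h J hJ]
    push_cast
    rfl
  rw [sum_congr rfl h', ← sum_mul, sum_powerset_neg_one_pow_card_of_nonempty hne, zero_mul]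

theorem sum_neg_one_pow_length_eq_zero {K : Finset W} (hK : (K : Set W) ⊆ Set.range cs.simple)
    (hne : K.Nonempty) :
    ∑ w with w ∈ Subgroup.closure (K : Set W), (-1 : ℤ) ^ cs.length w = 0 := by
  obtain ⟨s, hs⟩ := hne
  have hsP : s ∈ Subgroup.closure (K : Set W) := Subgroup.subset_closure hs
  have h : ∑ w with w ∈ Subgroup.closure (K : Set W), (-1 : ℤ) ^ cs.length w =
      ∑ w with w ∈ Subgroup.closure (K : Set W), -(-1 : ℤ) ^ cs.length w := by
    refine sum_bij' (fun w _ ↦ s * w) (fun w _ ↦ s⁻¹ * w) ?_ ?_ (by simp) (by simp) ?_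
    · simp [Subgroup.mul_mem_cancel_left _ hsP]
    · simp [Subgroup.mul_mem_cancel_left _ (inv_mem hsP)]
    · intro w _
      obtain ⟨i, rfl⟩ := hK hs
      rw [neg_one_pow_length_mul, length_simple]
      ring
  rw [sum_neg_distrib] at h
  lia

theorem solomonSum_eq {K : Finset W} (hK : (K : Set W) ⊆ Set.range cs.simple) {w : W}
    (hw : w ∈ Subgroup.closure (K : Set W)) : cs.solomonSum K w = (-1) ^ cs.length w := by
  induction K using Finset.strongInduction generalizing w with
  | H K ih =>
    obtain rfl | hne := K.eq_empty_or_nonempty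
    · rw [coe_empty, Subgroup.closure_empty, Subgroup.mem_bot] at hw
      subst hw
      have : ({x | x = 1} : Finset W) = {1} := by ext; simp
      simp [solomonSum, cardFixedMax, this]
    have dichotomy (w : W) (hw : w ∈ Subgroup.closure (K : Set W)) :
        cs.solomonSum K w = (-1) ^ cs.length w ∨ cs.solomonSum K w = (-1) ^ #K := by
      by_cases h : ∃ L ⊂ K, ∃ g ∈ Subgroup.closure (K : Set W),
          g * w * g⁻¹ ∈ Subgroup.closure (L : Set W)
      · obtain ⟨L, hL, g, hg, hgw⟩ := h
        left
        rw [← cs.solomonSum_conj hK hg, cs.solomonSum_eq_of_subset hK hL.subset hgw,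
          ih L hL ((coe_subset.2 hL.subset).trans hK) hgw, neg_one_pow_length_conj]
      · right
        push Not at h
        have h₁ : cs.cardFixedMax K K w = 1 := by
          refine Nat.eq_of_mul_eq_mul_right
            (Subgroup.card_filter_mem_pos (Subgroup.closure (K : Set W))) ?_
          rw [cs.cardFixedMax_mul_card hK subset_rfl, one_mul]
          congr 1
          refine filter_congr fun x _ ↦ ⟨fun h ↦ h.1, fun h ↦ ⟨h, ?_⟩⟩
          exact mul_mem (mul_mem h hw) (inv_mem h)
        rw [solomonSum, sum_eq_single_of_mem K (mem_powerset_self K), h₁, Nat.cast_one, mul_one]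
        intro J hJ hJK
        have hJ' : J ⊂ K := (mem_powerset.1 hJ).ssubset_of_ne hJK
        have h₀ : cs.cardFixedMax K J w = 0 := by
          rw [cardFixedMax, card_eq_zero, filter_eq_empty_iff]
          rintro x - ⟨h₁, -, h₂⟩
          exact h J hJ' x h₁ h₂
        rw [h₀, Nat.cast_zero, mul_zero]
    have nonneg (w : W) (hw : w ∈ ({w | w ∈ Subgroup.closure (K : Set W)} : Finset W)) :
        0 ≤ (-1) ^ #K * (cs.solomonSum K w - (-1) ^ cs.length w) := by
      simp only [mem_filter, mem_univ, true_and] at hw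
      obtain h | h := dichotomy w hw
      · simp [h]
      · rw [h]
        obtain h₁ | h₁ := neg_one_pow_eq_or ℤ #K <;>
        obtain h₂ | h₂ := neg_one_pow_eq_or ℤ (cs.length w) <;> simp [h₁, h₂]
    have hsum : ∑ w with w ∈ Subgroup.closure (K : Set W),
        (-1) ^ #K * (cs.solomonSum K w - (-1) ^ cs.length w) = 0 := by
      rw [← mul_sum, sum_sub_distrib, sum_solomonSum_eq_zero _ hK hne,
        sum_neg_one_pow_length_eq_zero _ hK hne, sub_zero, mul_zero]
    have h := (sum_eq_zero_iff_of_nonneg nonneg).1 hsum w (by simpa using hw)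
    have h' : ((-1 : ℤ) ^ #K) ≠ 0 := pow_ne_zero _ (by norm_num)
    exact sub_eq_zero.1 ((mul_eq_zero.1 h).resolve_left h')

theorem card_fixed_min_eq_cardFixedMax {K J : Finset W}
    (hK : (K : Set W) ⊆ Set.range cs.simple) (hJK : J ⊆ K) (w : W) :
    #{x : W | x ∈ Subgroup.closure (K : Set W) ∧
      (∀ s ∈ (J : Set W), ¬cs.IsLeftInversion x s) ∧
        x * w * x⁻¹ ∈ Subgroup.closure (J : Set W)} = cs.cardFixedMax K J w := by
  refine Nat.eq_of_mul_eq_mul_right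
    (Subgroup.card_filter_mem_pos (Subgroup.closure (J : Set W))) ?_
  rw [cs.cardFixedMax_mul_card hK hJK]
  convert Subgroup.card_filter_mul_card_of_existsUnique
    (R := fun x ↦ ∀ s ∈ (J : Set W), ¬cs.IsLeftInversion x s)
    (Subgroup.closure_mono (coe_subset.2 hJK))
    (cs.existsUnique_isCosetMin ((coe_subset.2 hJK).trans hK)) w

end CoxeterSystem

/-- Solomon's formula: `Σ_{J ⊆ S} (−1)^{|J|} π_J(w) = (−1)^{ℓ(w)}`, where `π_J(w)` is the
number of minimal length coset representatives `x ∈ X_J` with `x w x⁻¹ ∈ W_J`. -/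
theorem stmt_9 {B W : Type*} [Fintype B] [DecidableEq B] [Group W] [Finite W]
    {M : CoxeterMatrix B} (cs : CoxeterSystem M W) (w : W) :
    ∑ J : Finset B, (-1 : ℤ) ^ J.card *
        Nat.card {x : W // (∀ b ∈ J, cs.length x < cs.length (cs.simple b * x)) ∧
          x * w * x⁻¹ ∈ Subgroup.closure (cs.simple '' (J : Set B))} =
      (-1 : ℤ) ^ cs.length w := by
  classical
  have := Fintype.ofFinite W
  have hS : ((Finset.univ.image cs.simple : Finset W) : Set W) = Set.range cs.simple := by simp
  have hw : w ∈ Subgroup.closure ((Finset.univ.image cs.simple : Finset W) : Set W) := by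
    rw [hS, cs.subgroup_closure_range_simple]
    trivial
  rw [← cs.solomonSum_eq hS.subset hw, CoxeterSystem.solomonSum]
  have h := Finset.sum_powerset_neg_one_pow_card_mul_image cs.simple Finset.univ
    fun I ↦ (cs.cardFixedMax (Finset.univ.image cs.simple) I w : ℤ)
  rw [Finset.powerset_univ] at h
  convert h using 1
  refine Finset.sum_congr rfl fun J _ ↦ ?_
  congr 2
  rw [← cs.card_fixed_min_eq_cardFixedMax hS.subset
    (Finset.image_subset_image (Finset.subset_univ J)), Nat.card_eq_fintype_card,
    Fintype.card_subtype]
  congr 1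
  refine Finset.filter_congr fun x _ ↦ ?_
  have hdesc (b : B) : cs.length x < cs.length (cs.simple b * x) ↔
      ¬cs.IsLeftInversion x (cs.simple b) := by
    rw [cs.isLeftInversion_simple_iff_isLeftDescent, CoxeterSystem.IsLeftDescent, not_lt]
    exact ⟨le_of_lt, fun h ↦ lt_of_le_of_ne h (cs.length_simple_mul_ne x b).symm⟩
  rw [hS, cs.subgroup_closure_range_simple]
  simp [hdesc]
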